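/- Let p > 2, q₀ ∈ (0,∞), and let f : 𝔹 → ℂ be a Q-homeomorphism with respect to the p-modulus on the open unit disc 𝔹 whose function Q satisfies q(t) ≤ q₀ for almost every t ∈ (0,1), where q(t) = (1/(2πt)) ∫_{S_t} Q(z) |dz| is the integral mean of Q over the circle S_t = {z : |z| = t}. Then for every r ∈ [0,1], the area functional S_r(f) = |f(B_r)| satisfies S_r(f) ≥ π · q₀^{2/(2−p)} · r², where B_r = {z ∈ ℂ : |z| ≤ r}. -/

import Mathlib

open MeasureTheory Set Metric Complex ENNReal

noncomputable section

open Classical in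
/-- The line integral `∫_γ ρ |dz|` of a Borel density `ρ` along a curve `γ`
(parametrized on `[0,1]`), with the convention that the integral is `∞`
for curves that are not rectifiable (here: not Lipschitz on `[0,1]`). -/
def lineIntegral (ρ : ℂ → ℝ≥0∞) (γ : ℝ → ℂ) : ℝ≥0∞ :=
  if ∃ K : NNReal, LipschitzOnWith K γ (Set.Icc 0 1) then
    ∫⁻ t in Set.Icc (0 : ℝ) 1, ρ (γ t) * (‖deriv γ t‖₊ : ℝ≥0∞)
  else ⊤

/-- A Borel function `ρ : ℂ → [0,∞]` is admissible for the curve family `Γ`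
if `∫_γ ρ |dz| ≥ 1` for every `γ ∈ Γ`. -/
def IsAdmissible (ρ : ℂ → ℝ≥0∞) (Γ : Set (ℝ → ℂ)) : Prop :=
  Measurable ρ ∧ ∀ γ ∈ Γ, 1 ≤ lineIntegral ρ γ

/-- The `p`-modulus of a family `Γ` of curves in `ℂ`:
`M_p(Γ) = inf { ∫_ℂ ρ^p dm : ρ admissible for Γ }`. -/
def pModulus (p : ℝ) (Γ : Set (ℝ → ℂ)) : ℝ≥0∞ :=
  ⨅ (ρ : ℂ → ℝ≥0∞) (_ : IsAdmissible ρ Γ), ∫⁻ z : ℂ, ρ z ^ p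

/-- `Γ` is a family of curves lying in the set `D`. -/
def CurveFamilyIn (Γ : Set (ℝ → ℂ)) (D : Set ℂ) : Prop :=
  ∀ γ ∈ Γ, ContinuousOn γ (Set.Icc 0 1) ∧ ∀ t ∈ Set.Icc (0 : ℝ) 1, γ t ∈ D

/-- `f` is a homeomorphism of `D` onto its image: continuous, injective and open on `D`. -/
def IsHomeoOn (f : ℂ → ℂ) (D : Set ℂ) : Prop :=
  ContinuousOn f D ∧ Set.InjOn f D ∧ ∀ U ⊆ D, IsOpen U → IsOpen (f '' U)

/-- `f` is a `Q`-homeomorphism with respect to the `p`-modulus on `D`: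
`M_p(fΓ) ≤ ∫_D Q(z) ρ(z)^p dm(z)` for every curve family `Γ` in `D` and every
`ρ` admissible for `Γ`. -/
def IsQHomeo (p : ℝ) (D : Set ℂ) (Q : ℂ → ℝ≥0∞) (f : ℂ → ℂ) : Prop :=
  IsHomeoOn f D ∧
    ∀ Γ : Set (ℝ → ℂ), CurveFamilyIn Γ D → ∀ ρ : ℂ → ℝ≥0∞, IsAdmissible ρ Γ →
      pModulus p ((fun γ => f ∘ γ) '' Γ) ≤ ∫⁻ z in D, Q z * ρ z ^ p

/-- The integral mean `q_{z₀}(r) = (1/(2πr)) ∫_{S(z₀,r)} Q(z) |dz|` of `Q` over the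
circle `S(z₀,r)`, computed via the arclength parametrization `θ ↦ z₀ + r e^{iθ}`. -/
def circleMean (Q : ℂ → ℝ≥0∞) (z₀ : ℂ) (r : ℝ) : ℝ≥0∞ :=
  (∫⁻ θ in Set.Icc (0 : ℝ) (2 * Real.pi),
      Q (z₀ + (r : ℂ) * Complex.exp ((θ : ℂ) * Complex.I))) / ENNReal.ofReal (2 * Real.pi)


/-- Polar coordinates for nonnegative functions, with angles running over `[0, 2π]`. -/
lemma lintegral_eq_lintegral_polar {F : ℂ → ℝ≥0∞} (hF : Measurable F) :
    ∫⁻ z, F z = ∫⁻ t in Ioi (0 : ℝ), ∫⁻ θ in Icc (0 : ℝ) (2 * Real.pi),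
      ENNReal.ofReal t * F ((t : ℂ) * Complex.exp ((θ : ℂ) * Complex.I)) := by
  have hneg : ∫⁻ z, F z = ∫⁻ z, F (-z) :=
    ((Measure.measurePreserving_neg (volume : Measure ℂ)).lintegral_comp hF).symm
  rw [hneg, ← Complex.lintegral_comp_polarCoord_symm, polarCoord_target,
    Measure.volume_eq_prod, ← Measure.prod_restrict, lintegral_prod _ (by
      apply Measurable.aemeasurable
      simp only [Complex.polarCoord_symm_apply, smul_eq_mul]
      fun_prop)]
  refine lintegral_congr fun t => ?_
  have hshift := (measurePreserving_add_right (volume : Measure ℝ)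
    Real.pi).setLIntegral_comp_preimage_emb (measurableEmbedding_addRight Real.pi)
    (fun θ : ℝ => ENNReal.ofReal t * F ((t : ℂ) * Complex.exp ((θ : ℂ) * Complex.I)))
    (Ioo 0 (2 * Real.pi))
  have hpre : (fun x : ℝ => x + Real.pi) ⁻¹' Ioo 0 (2 * Real.pi) = Ioo (-Real.pi) Real.pi := by
    rw [Set.preimage_add_const_Ioo]
    congr 1 <;> ring
  rw [hpre] at hshift
  rw [setLIntegral_congr Ioo_ae_eq_Icc.symm, ← hshift]
  refine lintegral_congr fun θ => ?_
  rw [smul_eq_mul, Complex.polarCoord_symm_apply]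
  congr 2
  push_cast
  rw [add_mul, Complex.exp_add, Complex.exp_pi_mul_I, Complex.exp_mul_I]
  ring

/-- The exponent `(p - 2) / (p - 1)` of the `p`-harmonic radial function in the plane. -/
def radialExponent (p : ℝ) : ℝ := (p - 2) / (p - 1)

/-- The extremal density for the `p`-modulus of the curves joining the centre of a disc of
radius `R` to its boundary, as a function of the distance to the centre. -/
def radialDensity (p R t : ℝ) : ℝ :=
  radialExponent p * R ^ (-radialExponent p) * t ^ (radialExponent p - 1)

lemma measurable_radialDensity (p R : ℝ) : Measurable (radialDensity p R) := by
  unfold radialDensity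
  fun_prop

lemma radialExponent_pos {p : ℝ} (hp : 2 < p) : 0 < radialExponent p :=
  div_pos (by linarith) (by linarith)

lemma radialExponent_lt_one {p : ℝ} (hp : 2 < p) : radialExponent p < 1 :=
  (div_lt_one (by linarith)).2 (by linarith)

lemma radialDensity_nonneg {p R t : ℝ} (hp : 2 < p) (hR : 0 ≤ R) (ht : 0 ≤ t) :
    0 ≤ radialDensity p R t := by
  have := radialExponent_pos hp
  unfold radialDensity
  positivity

/-- `(2π)⁻¹` times the `p`-modulus of the curves joining the centre of a disc of radius `R`
to its boundary. -/
def radialModulus (p R : ℝ) : ℝ := radialExponent p ^ (p - 1) * R ^ (2 - p)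

lemma radialModulus_nonneg {p R : ℝ} (hp : 2 < p) (hR : 0 ≤ R) : 0 ≤ radialModulus p R := by
  have := radialExponent_pos hp
  unfold radialModulus
  positivity

lemma mul_radialDensity_rpow_sub_one {p R t : ℝ} (hp : 2 < p) (hR : 0 < R) (ht : 0 < t) :
    t * radialDensity p R t ^ (p - 1) = radialModulus p R := by
  have hα := radialExponent_pos hp
  have h1 : radialExponent p * (p - 1) = p - 2 := div_mul_cancel₀ _ (by linarith)
  unfold radialDensity radialModulus
  rw [Real.mul_rpow (by positivity) (by positivity), Real.mul_rpow (by positivity) (by positivity),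
    ← Real.rpow_mul hR.le, ← Real.rpow_mul ht.le,
    show -radialExponent p * (p - 1) = 2 - p by linarith,
    show (radialExponent p - 1) * (p - 1) = -1 by linarith, Real.rpow_neg_one]
  field_simp

lemma mul_radialDensity_rpow {p R t : ℝ} (hp : 2 < p) (hR : 0 < R) (ht : 0 < t) :
    t * radialDensity p R t ^ p = radialModulus p R * radialDensity p R t := by
  rw [← mul_radialDensity_rpow_sub_one hp hR ht, mul_assoc, ← Real.rpow_add_one']
  · simp
  · exact radialDensity_nonneg hp hR.le ht.le
  · linarith

lemma lintegral_radialDensity {p R : ℝ} (hp : 2 < p) (hR : 0 < R) :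
    ∫⁻ t in Ioc 0 R, ENNReal.ofReal (radialDensity p R t) = 1 := by
  have hα := radialExponent_pos hp
  have hint : IntervalIntegrable (fun t : ℝ => t ^ (radialExponent p - 1)) volume 0 R :=
    intervalIntegral.intervalIntegrable_rpow' (by linarith)
  rw [← ofReal_integral_eq_lintegral_ofReal]
  · rw [← intervalIntegral.integral_of_le hR.le]
    unfold radialDensity
    rw [intervalIntegral.integral_const_mul, integral_rpow (Or.inl (by linarith))]
    simp only [sub_add_cancel, Real.zero_rpow hα.ne', sub_zero]
    rw [Real.rpow_neg hR.le]
    have : R ^ radialExponent p ≠ 0 := (Real.rpow_pos_of_pos hR _).ne'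
    field_simp
    simp
  · exact ((intervalIntegrable_iff_integrableOn_Ioc_of_le hR.le).1 hint).const_mul _
  · exact (ae_restrict_iff' measurableSet_Ioc).2
      (ae_of_all _ fun t ht => radialDensity_nonneg hp hR.le ht.1.le)

lemma setLIntegral_mul_radialDensity_le {p q₀ r : ℝ} (hp : 2 < p) (hr : 0 < r)
    {Q : ℂ → ℝ≥0∞} (hQ : Measurable Q)
    (hq : ∀ᵐ t ∂(volume.restrict (Ioc (0 : ℝ) r)), circleMean Q 0 t ≤ ENNReal.ofReal q₀) :
    ∫⁻ z in closedBall (0 : ℂ) r, Q z * ENNReal.ofReal (radialDensity p r ‖z‖) ^ p ≤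
      ENNReal.ofReal (2 * Real.pi) * ENNReal.ofReal q₀ * ENNReal.ofReal (radialModulus p r) := by
  have hρ := measurable_radialDensity p r
  have hpi : 0 < 2 * Real.pi := by positivity
  rw [← lintegral_indicator isClosed_closedBall.measurableSet, lintegral_eq_lintegral_polar
    ((by fun_prop : Measurable _).indicator isClosed_closedBall.measurableSet)]
  calc
    _ = ∫⁻ t in Ioc 0 r, ∫⁻ θ in Icc (0 : ℝ) (2 * Real.pi), ENNReal.ofReal t *
          (Q ((t : ℂ) * Complex.exp ((θ : ℂ) * Complex.I)) *
            ENNReal.ofReal (radialDensity p r t) ^ p) := by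
      rw [← Ioi_inter_Iic, Set.inter_comm, ← setLIntegral_indicator measurableSet_Iic]
      refine setLIntegral_congr_fun measurableSet_Ioi fun t (ht : 0 < t) => ?_
      by_cases htr : t ≤ r
      · simp [htr, Complex.norm_exp_ofReal_mul_I, abs_of_pos ht]
      · simp [htr, Complex.norm_exp_ofReal_mul_I, abs_of_pos ht]
    _ ≤ ∫⁻ t in Ioc 0 r, ENNReal.ofReal (2 * Real.pi) * ENNReal.ofReal q₀ *
          ENNReal.ofReal (radialModulus p r) * ENNReal.ofReal (radialDensity p r t) := by
      refine lintegral_mono_ae ?_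
      filter_upwards [hq, ae_restrict_mem measurableSet_Ioc] with t hqt ht
      have hd := radialDensity_nonneg hp hr.le ht.1.le
      rw [circleMean, ENNReal.div_le_iff (by simpa using hpi) ENNReal.ofReal_ne_top] at hqt
      simp only [zero_add] at hqt
      rw [lintegral_const_mul _ (by fun_prop), lintegral_mul_const _ (by fun_prop),
        ENNReal.ofReal_rpow_of_nonneg hd (by linarith), mul_left_comm, ← ENNReal.ofReal_mul ht.1.le,
        mul_radialDensity_rpow hp hr ht.1, mul_assoc (_ * _),
        ← ENNReal.ofReal_mul (radialModulus_nonneg hp hr.le)]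
      gcongr
      rwa [mul_comm (ENNReal.ofReal (2 * Real.pi))]
    _ = _ := by
      rw [lintegral_const_mul _ (by fun_prop), lintegral_radialDensity hp hr, mul_one]

lemma setLIntegral_le_of_measure_le {α : Type*} [MeasurableSpace α] {μ : Measure α}
    {F : α → ℝ≥0∞} {A B : Set α} (hA : MeasurableSet A) (hB : MeasurableSet B)
    (hμ : μ A ≤ μ B) (hfin : μ A ≠ ⊤) {c : ℝ≥0∞} (hout : ∀ z ∉ B, F z ≤ c)
    (hin : ∀ z ∈ B, c ≤ F z) : ∫⁻ z in A, F z ∂μ ≤ ∫⁻ z in B, F z ∂μ := by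
  have hdiff : μ (A \ B) ≤ μ (B \ A) := by
    rw [← measure_inter_add_sdiff A hB, ← measure_inter_add_sdiff B hA, inter_comm B A] at hμ
    exact (ENNReal.add_le_add_iff_left (measure_ne_top_of_subset inter_subset_left hfin)).1 hμ
  rw [← lintegral_inter_add_sdiff F A hB, ← lintegral_inter_add_sdiff F B hA, inter_comm B A]
  gcongr 1
  calc
    ∫⁻ z in A \ B, F z ∂μ ≤ ∫⁻ _ in A \ B, c ∂μ :=
      setLIntegral_mono' (hA.diff hB) fun z hz => hout z hz.2
    _ ≤ ∫⁻ _ in B \ A, c ∂μ := by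
      simp only [setLIntegral_const]
      gcongr
    _ ≤ ∫⁻ z in B \ A, F z ∂μ := setLIntegral_mono' (hB.diff hA) fun z hz => hin z hz.1

lemma radialDensity_anti {p R s t : ℝ} (hp : 2 < p) (hR : 0 ≤ R) (hs : 0 < s) (hst : s ≤ t) :
    radialDensity p R t ≤ radialDensity p R s := by
  have := radialExponent_pos hp
  have h1 := radialExponent_lt_one hp
  unfold radialDensity
  exact mul_le_mul_of_nonneg_left (Real.rpow_le_rpow_of_nonpos hs hst (by linarith))
    (by positivity)

lemma setLIntegral_radialDensity_le {p R : ℝ} (hp : 2 < p) (hR : 0 < R) {A : Set ℂ}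
    (hA : MeasurableSet A) (hvol : volume A ≤ volume (closedBall (0 : ℂ) R)) :
    ∫⁻ z in A, ENNReal.ofReal (radialDensity p R ‖z‖) ^ p ≤
      ENNReal.ofReal (2 * Real.pi) * ENNReal.ofReal (radialModulus p R) := by
  have hp0 : 0 ≤ p := by linarith
  calc
    _ ≤ ∫⁻ z in closedBall (0 : ℂ) R \ {0}, ENNReal.ofReal (radialDensity p R ‖z‖) ^ p := by
      refine setLIntegral_le_of_measure_le hA
        (isClosed_closedBall.measurableSet.diff (measurableSet_singleton _))
        (by rwa [measure_sdiff_null (measure_singleton _)])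
        (hvol.trans_lt measure_closedBall_lt_top).ne
        (c := ENNReal.ofReal (radialDensity p R R) ^ p) (fun z hz => ?_) (fun z hz => ?_)
      · rcases eq_or_ne z 0 with rfl | hz0
        · have : radialExponent p - 1 ≠ 0 := by linarith [radialExponent_lt_one hp]
          simp [radialDensity, Real.zero_rpow this, show 0 < p by linarith]
        · have : R < ‖z‖ := by simpa [hz0] using hz
          gcongr
          exact radialDensity_anti hp hR.le hR this.le
      · have hz' : ‖z‖ ≤ R ∧ z ≠ 0 := by simpa using hz
        gcongr
        exact radialDensity_anti hp hR.le (norm_pos_iff.2 hz'.2) hz'.1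
    _ ≤ ∫⁻ z in closedBall (0 : ℂ) R, ENNReal.ofReal (radialDensity p R ‖z‖) ^ p :=
      lintegral_mono_set sdiff_subset
    _ ≤ _ := by
      simpa using setLIntegral_mul_radialDensity_le (q₀ := 1) hp hR
        (measurable_const (a := (1 : ℝ≥0∞)))
        (ae_of_all _ fun t => by simp [circleMean])

lemma mul_mul_rpow_le_rpow_add {p : ℝ} (hp : 1 < p) (a b : ℝ≥0∞) :
    ENNReal.ofReal p * (a * b ^ (p - 1)) ≤ a ^ p + ENNReal.ofReal (p - 1) * b ^ p := by
  have hc : p.HolderConjugate (p / (p - 1)) := Real.HolderConjugate.conjExponent hp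
  have hp0 : 0 < p := by linarith
  have hp1 : 0 < p - 1 := by linarith
  have hy := mul_le_mul_right (ENNReal.young_inequality a (b ^ (p - 1)) hc) (ENNReal.ofReal p)
  refine hy.trans_eq ?_
  rw [mul_add, ENNReal.mul_div_cancel (by simpa using hp0) ENNReal.ofReal_ne_top,
    ← ENNReal.rpow_mul, mul_div_cancel₀ _ hp1.ne', ← mul_div_assoc, mul_comm (ENNReal.ofReal p),
    mul_div_assoc, ← ENNReal.ofReal_div_of_pos (by positivity), mul_comm (b ^ p)]
  congr 3
  field_simp

lemma radialModulus_le_lintegral {p R : ℝ} (hp : 2 < p) (hR : 0 < R) {A : Set ℂ}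
    (hA : MeasurableSet A) (hvol : volume A ≤ volume (closedBall (0 : ℂ) R))
    {ρ : ℂ → ℝ≥0∞} (hρ : Measurable ρ)
    (hray : ∀ θ : ℝ, 1 ≤ ∫⁻ t in Ioi (0 : ℝ),
      A.indicator ρ ((t : ℂ) * Complex.exp ((θ : ℂ) * Complex.I))) :
    ENNReal.ofReal (2 * Real.pi) * ENNReal.ofReal (radialModulus p R) ≤ ∫⁻ z, ρ z ^ p := by
  have hk := measurable_radialDensity p R
  have hρA : Measurable (A.indicator ρ) := hρ.indicator hA
  have hpolar : ENNReal.ofReal (2 * Real.pi) * ENNReal.ofReal (radialModulus p R) ≤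
      ∫⁻ z in A, ρ z * ENNReal.ofReal (radialDensity p R ‖z‖) ^ (p - 1) := by
    calc
      _ ≤ ∫⁻ θ in Icc (0 : ℝ) (2 * Real.pi), ENNReal.ofReal (radialModulus p R) *
          ∫⁻ t in Ioi (0 : ℝ), A.indicator ρ ((t : ℂ) * Complex.exp ((θ : ℂ) * Complex.I)) := by
        calc
          _ = ∫⁻ θ in Icc (0 : ℝ) (2 * Real.pi), ENNReal.ofReal (radialModulus p R) * 1 := by
            simp [mul_comm]
          _ ≤ _ := lintegral_mono fun θ => by gcongr; exact hray θ
      _ = ∫⁻ θ in Icc (0 : ℝ) (2 * Real.pi), ∫⁻ t in Ioi (0 : ℝ),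
          ENNReal.ofReal t * (A.indicator ρ ((t : ℂ) * Complex.exp ((θ : ℂ) * Complex.I)) *
            ENNReal.ofReal (radialDensity p R
              ‖(t : ℂ) * Complex.exp ((θ : ℂ) * Complex.I)‖) ^ (p - 1)) := by
        refine lintegral_congr fun θ => ?_
        rw [← lintegral_const_mul _ (by fun_prop)]
        refine setLIntegral_congr_fun measurableSet_Ioi fun t (ht : 0 < t) => ?_
        have hd := radialDensity_nonneg hp hR.le ht.le
        simp only [norm_mul, Complex.norm_exp_ofReal_mul_I, mul_one, Complex.norm_real,
          Real.norm_eq_abs, abs_of_pos ht]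
        rw [ENNReal.ofReal_rpow_of_nonneg hd (by linarith), mul_left_comm,
          ← ENNReal.ofReal_mul ht.le, mul_radialDensity_rpow_sub_one hp hR ht, mul_comm]
      _ = ∫⁻ z in A, ρ z * ENNReal.ofReal (radialDensity p R ‖z‖) ^ (p - 1) := by
        rw [lintegral_lintegral_swap (by fun_prop), ← lintegral_indicator hA]
        simp_rw [Set.indicator_mul_left]
        rw [lintegral_eq_lintegral_polar (by fun_prop)]
  have hyoung := calc
    ENNReal.ofReal p * (ENNReal.ofReal (2 * Real.pi) * ENNReal.ofReal (radialModulus p R))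
      ≤ ENNReal.ofReal p * ∫⁻ z in A, ρ z * ENNReal.ofReal (radialDensity p R ‖z‖) ^ (p - 1) := by
        gcongr
    _ = ∫⁻ z in A, ENNReal.ofReal p *
          (ρ z * ENNReal.ofReal (radialDensity p R ‖z‖) ^ (p - 1)) :=
        (lintegral_const_mul _ (by fun_prop)).symm
    _ ≤ ∫⁻ z in A, (ρ z ^ p +
          ENNReal.ofReal (p - 1) * ENNReal.ofReal (radialDensity p R ‖z‖) ^ p) :=
        lintegral_mono fun z => mul_mul_rpow_le_rpow_add (by linarith) _ _
    _ = (∫⁻ z in A, ρ z ^ p) + ENNReal.ofReal (p - 1) *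
          ∫⁻ z in A, ENNReal.ofReal (radialDensity p R ‖z‖) ^ p := by
        rw [lintegral_add_left (by fun_prop), lintegral_const_mul _ (by fun_prop)]
    _ ≤ (∫⁻ z, ρ z ^ p) + ENNReal.ofReal (p - 1) *
          (ENNReal.ofReal (2 * Real.pi) * ENNReal.ofReal (radialModulus p R)) := by
        gcongr
        · exact Measure.restrict_le_self
        · exact setLIntegral_radialDensity_le hp hR hA hvol
  rw [show p = 1 + (p - 1) by ring, ENNReal.ofReal_add zero_le_one (by linarith), add_mul,
    ENNReal.ofReal_one, one_mul] at hyoung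
  simp only [add_sub_cancel_left] at hyoung
  rw [add_sub_cancel] at hyoung
  exact (ENNReal.add_le_add_iff_right (by finiteness)).1 hyoung

lemma rpow_le_setLIntegral_of_lipschitzOnWith {α : ℝ} (hα : 0 < α) (hα1 : α < 1)
    {γ : ℝ → ℂ} {K : NNReal} (hγ : LipschitzOnWith K γ (Icc 0 1)) (h0 : γ 0 = 0) :
    ENNReal.ofReal (‖γ 1‖ ^ α) ≤
      ∫⁻ t in Icc (0 : ℝ) 1, ENNReal.ofReal (α * ‖γ t‖ ^ (α - 1)) * (‖deriv γ t‖₊ : ℝ≥0∞) := by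
  have hbound : ∀ ε : ℝ, 0 < ε → ENNReal.ofReal ((‖γ 1‖ ^ 2 + ε) ^ (α / 2) - ε ^ (α / 2)) ≤
      ∫⁻ t in Icc (0 : ℝ) 1,
        ENNReal.ofReal (α * ‖γ t‖ ^ (α - 1)) * (‖deriv γ t‖₊ : ℝ≥0∞) := by
    intro ε hε
    set G : ℂ → ℝ := fun z => (‖z‖ ^ 2 + ε) ^ (α / 2) with hG
    have hpos : ∀ z : ℂ, 0 < ‖z‖ ^ 2 + ε := fun z => by positivity
    have hGd : ∀ z : ℂ, HasFDerivAt G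
        ((α / 2 * (‖z‖ ^ 2 + ε) ^ (α / 2 - 1)) • (2 • innerSL ℝ z)) z := fun z => by
      have h := ((hasStrictFDerivAt_norm_sq z).hasFDerivAt.add_const ε).rpow_const
        (p := α / 2) (Or.inl (hpos z).ne')
      simpa using h
    have hGc : ContDiff ℝ 1 G :=
      ((contDiff_norm_sq ℝ).add contDiff_const).rpow_const_of_ne fun z => (hpos z).ne'
    obtain ⟨K', hK'⟩ := (hGc.locallyLipschitz.locallyLipschitzOn
      (s := γ '' Icc 0 1)).exists_lipschitzOnWith_of_compact (isCompact_Icc.image_of_continuousOn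
        hγ.continuousOn)
    have hcomp : LipschitzOnWith (K' * K) (G ∘ γ) (Icc 0 1) := hK'.comp hγ (mapsTo_image _ _)
    have hftc := (LipschitzOnWith.absolutelyContinuousOnInterval (a := 0) (b := 1)
      (by rwa [uIcc_of_le zero_le_one])).integral_deriv_eq_sub (f := G ∘ γ)
    have hval : (‖γ 1‖ ^ 2 + ε) ^ (α / 2) - ε ^ (α / 2) = ∫ t in Ioc (0 : ℝ) 1,
        deriv (G ∘ γ) t := by
      rw [← intervalIntegral.integral_of_le zero_le_one, hftc]
      simp [hG, h0]
    rw [hval, setLIntegral_congr Ioc_ae_eq_Icc.symm]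
    refine ((Real.ofReal_le_enorm _).trans (enorm_integral_le_lintegral_enorm _)).trans
      (lintegral_mono_ae ?_)
    rw [← restrict_Ioo_eq_restrict_Ioc]
    filter_upwards [ae_restrict_mem measurableSet_Ioo,
      ae_restrict_of_ae hγ.ae_differentiableWithinAt_of_mem_real] with t ht hd
    have hdγ : DifferentiableAt ℝ γ t :=
      (hd (Ioo_subset_Icc_self ht)).differentiableAt (Icc_mem_nhds ht.1 ht.2)
    rw [((hGd (γ t)).comp_hasDerivAt t hdγ.hasDerivAt).deriv]
    set z := γ t
    set v := deriv γ t
    rw [← ofReal_norm, ← enorm_eq_nnnorm, ← ofReal_norm, ← ENNReal.ofReal_mul (by positivity)]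
    refine ENNReal.ofReal_le_ofReal ?_
    have hinner : |inner ℝ z v| ≤ ‖z‖ * ‖v‖ := abs_real_inner_le_norm z v
    have hnorm : ‖((α / 2 * (‖z‖ ^ 2 + ε) ^ (α / 2 - 1)) • (2 • innerSL ℝ z)) v‖ =
        α * (‖z‖ ^ 2 + ε) ^ (α / 2 - 1) * |inner ℝ z v| := by
      have := hpos z
      simp only [_root_.smul_apply, innerSL_apply_apply, nsmul_eq_mul, smul_eq_mul,
        norm_mul, Real.norm_eq_abs]
      rw [abs_of_pos (half_pos hα), abs_of_pos (by positivity)]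
      norm_num
      ring
    rw [hnorm]
    rcases eq_or_ne z 0 with hz | hz
    · simp [hz]
      positivity
    have hzpos := norm_pos_iff.2 hz
    calc
      α * (‖z‖ ^ 2 + ε) ^ (α / 2 - 1) * |inner ℝ z v|
        ≤ α * (‖z‖ ^ 2) ^ (α / 2 - 1) * (‖z‖ * ‖v‖) := by
          gcongr ?_ * ?_ * ?_
          exact Real.rpow_le_rpow_of_nonpos (by positivity) (by linarith) (by linarith)
      _ = α * ‖z‖ ^ (α - 1) * ‖v‖ := by
          rw [← Real.rpow_natCast, ← Real.rpow_mul hzpos.le,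
            show α - 1 = ((2 : ℕ) : ℝ) * (α / 2 - 1) + 1 by push_cast; ring,
            Real.rpow_add_one hzpos.ne']
          ring
  have hlim : Filter.Tendsto
      (fun ε : ℝ => ENNReal.ofReal ((‖γ 1‖ ^ 2 + ε) ^ (α / 2) - ε ^ (α / 2)))
      (nhdsWithin 0 (Ioi 0)) (nhds (ENNReal.ofReal (‖γ 1‖ ^ α))) := by
    have hc : Continuous fun ε : ℝ =>
        ENNReal.ofReal ((‖γ 1‖ ^ 2 + ε) ^ (α / 2) - ε ^ (α / 2)) := by
      refine ENNReal.continuous_ofReal.comp (Continuous.sub ?_ ?_)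
      · exact (continuous_const.add continuous_id).rpow_const fun _ => Or.inr (by positivity)
      · exact continuous_id.rpow_const fun _ => Or.inr (by positivity)
    have h := (hc.tendsto 0).mono_left (nhdsWithin_le_nhds (s := Ioi 0))
    have hpow : (‖γ 1‖ ^ 2) ^ (α / 2) = ‖γ 1‖ ^ α := by
      rw [← Real.rpow_natCast, ← Real.rpow_mul (norm_nonneg _)]
      congr 1
      push_cast
      ring
    simpa only [add_zero, Real.zero_rpow (half_pos hα).ne', sub_zero, hpow] using h
  exact le_of_tendsto hlim (Filter.eventually_of_mem self_mem_nhdsWithin hbound)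

lemma exists_first_exit {A : Set ℂ} (hA : IsOpen A) (hb : Bornology.IsBounded A) {w u : ℂ}
    (hw : w ∈ A) (hu : ‖u‖ = 1) :
    ∃ L : ℝ, 0 < L ∧ (∀ s ∈ Ico 0 L, w + s * u ∈ A) ∧ w + L * u ∈ frontier A := by
  set T : Set ℝ := {s | 0 ≤ s ∧ w + s * u ∉ A} with hT
  have hcont : Continuous fun s : ℝ => w + s * u := by fun_prop
  have hTc : IsClosed T := isClosed_Ici.inter (hA.preimage hcont).isClosed_compl
  have hTb : BddBelow T := ⟨0, fun s hs => hs.1⟩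
  have hTn : T.Nonempty := by
    obtain ⟨C, hC⟩ := hb.subset_ball w
    refine ⟨max C 0, le_max_right _ _, fun hmem => ?_⟩
    have := hC hmem
    have hlt : |max C 0| < C := by simpa [hu] using this
    exact (((le_max_left C 0).trans (le_abs_self _)).trans_lt hlt).false
  have hL := hTc.csInf_mem hTn hTb
  have hlt : ∀ s ∈ Ico 0 (sInf T), w + s * u ∈ A := fun s hs => by
    by_contra hs'
    exact (csInf_le hTb ⟨hs.1, hs'⟩).not_gt hs.2
  have hpos : 0 < sInf T := lt_of_le_of_ne hL.1 fun h => hL.2 (by simpa [← h] using hw)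
  refine ⟨sInf T, hpos, hlt, ?_⟩
  rw [hA.frontier_eq]
  refine ⟨?_, hL.2⟩
  have hcl : sInf T ∈ closure (Ico 0 (sInf T)) := by
    rw [closure_Ico hpos.ne]
    exact right_mem_Icc.2 hpos.le
  exact closure_mono (image_subset_iff.2 hlt) (image_closure_subset_closure_image hcont
    (mem_image_of_mem _ hcl))

lemma lineIntegral_congr {ρ : ℂ → ℝ≥0∞} {γ σ : ℝ → ℂ} (h : EqOn γ σ (Icc 0 1)) :
    lineIntegral ρ γ = lineIntegral ρ σ := by
  unfold lineIntegral
  congr 1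
  · exact propext (exists_congr fun K =>
      ⟨fun hγ x hx y hy => h hx ▸ h hy ▸ hγ hx hy, fun hσ x hx y hy => by
        rw [h hx, h hy]; exact hσ hx hy⟩)
  · rw [setLIntegral_congr Ioo_ae_eq_Icc.symm, setLIntegral_congr Ioo_ae_eq_Icc.symm]
    refine setLIntegral_congr_fun measurableSet_Ioo fun t ht => ?_
    have he : γ =ᶠ[nhds t] σ := Filter.eventuallyEq_of_mem (Icc_mem_nhds ht.1 ht.2) h
    simp only [h (Ioo_subset_Icc_self ht), he.deriv_eq]

lemma lineIntegral_segment {ρ : ℂ → ℝ≥0∞} {w u : ℂ} (hu : ‖u‖ = 1) {L : ℝ}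
    (hL : 0 < L) : lineIntegral ρ (fun t : ℝ => w + ((t * L : ℝ) : ℂ) * u) =
      ∫⁻ s in Ioo 0 L, ρ (w + s * u) := by
  have hd : ∀ t : ℝ, HasDerivAt (fun t : ℝ => w + ((t * L : ℝ) : ℂ) * u) (L * u) t := fun t => by
    have h : HasDerivAt (fun t : ℝ => t * L) L t := by simpa using (hasDerivAt_id t).mul_const L
    exact (h.ofReal_comp.mul_const u).const_add w
  have hlip : LipschitzOnWith ‖(L : ℂ) * u‖₊ (fun t : ℝ => w + ((t * L : ℝ) : ℂ) * u) (Icc 0 1) :=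
    (lipschitzWith_of_nnnorm_deriv_le (fun t => (hd t).differentiableAt)
      fun t => by rw [(hd t).deriv]).lipschitzOnWith
  have himg : (fun t : ℝ => t * L) '' Ioo 0 1 = Ioo 0 L := by
    rw [image_mul_right_Ioo _ _ hL]
    simp
  rw [lineIntegral, if_pos ⟨_, hlip⟩, setLIntegral_congr Ioo_ae_eq_Icc.symm, ← himg,
    lintegral_image_eq_lintegral_abs_deriv_mul measurableSet_Ioo (f' := fun _ => L)
      (fun t _ => by simpa using ((hasDerivAt_id t).mul_const L).hasDerivWithinAt)
      (mul_left_injective₀ hL.ne').injOn]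
  refine lintegral_congr fun t => ?_
  rw [(hd t).deriv, mul_comm, ← enorm_eq_nnnorm, ← ofReal_norm]
  simp [hu]

lemma IsHomeoOn.continuousOn_invFunOn {f : ℂ → ℂ} {D : Set ℂ} (hf : IsHomeoOn f D)
    (hD : IsOpen D) : ContinuousOn (Function.invFunOn f D) (f '' D) := by
  have hleft := hf.2.1.leftInvOn_invFunOn
  refine (continuousOn_open_iff (hf.2.2 D subset_rfl hD)).2 fun t ht => ?_
  convert hf.2.2 (D ∩ t) inter_subset_left (hD.inter ht) using 1
  ext y
  constructor
  · rintro ⟨⟨x, hx, rfl⟩, hy⟩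
    exact ⟨x, ⟨hx, by simpa [hleft hx] using hy⟩, rfl⟩
  · rintro ⟨x, ⟨hx, hxt⟩, rfl⟩
    exact ⟨mem_image_of_mem f hx, by simpa [hleft hx] using hxt⟩

/-- The curves in the closed disc of radius `r` joining the centre to the boundary circle. -/
def radialCurves (r : ℝ) : Set (ℝ → ℂ) :=
  {γ | ContinuousOn γ (Icc 0 1) ∧ MapsTo γ (Icc 0 1) (closedBall 0 r) ∧ γ 0 = 0 ∧ ‖γ 1‖ = r}

lemma isAdmissible_radialDensity {p r : ℝ} (hp : 2 < p) (hr : 0 < r) :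
    IsAdmissible ((closedBall (0 : ℂ) r).indicator
      fun z => ENNReal.ofReal (radialDensity p r ‖z‖)) (radialCurves r) := by
  have hρ := measurable_radialDensity p r
  have hα := radialExponent_pos hp
  refine ⟨Measurable.indicator (by fun_prop) isClosed_closedBall.measurableSet, ?_⟩
  rintro γ ⟨-, hmaps, h0, h1⟩
  unfold lineIntegral
  split_ifs with hlip
  · obtain ⟨K, hK⟩ := hlip
    have hlen := rpow_le_setLIntegral_of_lipschitzOnWith hα (radialExponent_lt_one hp) hK h0
    rw [h1] at hlen
    have hrpos : 0 < r ^ radialExponent p := Real.rpow_pos_of_pos hr _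
    calc
      (1 : ℝ≥0∞) = ENNReal.ofReal (r ^ (-radialExponent p)) *
          ENNReal.ofReal (r ^ radialExponent p) := by
        rw [← ENNReal.ofReal_mul (by positivity), Real.rpow_neg hr.le,
          inv_mul_cancel₀ hrpos.ne', ENNReal.ofReal_one]
      _ ≤ ENNReal.ofReal (r ^ (-radialExponent p)) * ∫⁻ t in Icc (0 : ℝ) 1,
          ENNReal.ofReal (radialExponent p * ‖γ t‖ ^ (radialExponent p - 1)) *
            (‖deriv γ t‖₊ : ℝ≥0∞) := by gcongr
      _ = _ := by
        rw [← lintegral_const_mul' _ _ ENNReal.ofReal_ne_top]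
        refine setLIntegral_congr_fun measurableSet_Icc fun t ht => ?_
        simp only [indicator_of_mem (hmaps ht)]
        rw [← mul_assoc, ← ENNReal.ofReal_mul (by positivity), radialDensity]
        congr 2
        ring
  · exact le_top

lemma IsHomeoOn.exists_radialCurve_segment {f : ℂ → ℂ} (hf : IsHomeoOn f (ball 0 1)) {r : ℝ}
    (hr : 0 < r) (hr1 : r < 1) {u : ℂ} (hu : ‖u‖ = 1) :
    ∃ L : ℝ, 0 < L ∧ (∀ s ∈ Ico 0 L, f 0 + s * u ∈ f '' ball 0 r) ∧
      ∃ γ ∈ radialCurves r,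
        EqOn (f ∘ γ) (fun t : ℝ => f 0 + ((t * L : ℝ) : ℂ) * u) (Icc 0 1) := by
  have hsub : closedBall (0 : ℂ) r ⊆ ball 0 1 := closedBall_subset_ball hr1
  have hcpt : IsCompact (f '' closedBall 0 r) :=
    (isCompact_closedBall 0 r).image_of_continuousOn (hf.1.mono hsub)
  have hopen : IsOpen (f '' ball 0 r) :=
    hf.2.2 _ (ball_subset_closedBall.trans hsub) isOpen_ball
  have hAsub : f '' ball 0 r ⊆ f '' closedBall 0 r := image_mono ball_subset_closedBall
  have h0r : (0 : ℂ) ∈ ball 0 r := mem_ball_self hr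
  obtain ⟨L, hL, hseg, hexit⟩ := exists_first_exit hopen (hcpt.isBounded.subset hAsub)
    (mem_image_of_mem f h0r) hu
  have hleft := hf.2.1.leftInvOn_invFunOn
  rw [hopen.frontier_eq] at hexit
  obtain ⟨x, hx, hfx⟩ := closure_minimal hAsub hcpt.isClosed hexit.1
  have hxr : ‖x‖ = r := by
    refine le_antisymm (by simpa using hx)
      (not_lt.1 fun hlt => hexit.2 ⟨x, by simpa using hlt, hfx⟩)
  have hmem : ∀ t ∈ Icc (0 : ℝ) 1,
      f 0 + ((t * L : ℝ) : ℂ) * u ∈ f '' closedBall 0 r := fun t ht => by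
    rcases eq_or_lt_of_le ht.2 with rfl | ht1
    · exact ⟨x, hx, by simpa using hfx⟩
    · exact hAsub (hseg _ ⟨mul_nonneg ht.1 hL.le, by nlinarith⟩)
  refine ⟨L, hL, hseg,
    fun t => Function.invFunOn f (ball 0 1) (f 0 + ((t * L : ℝ) : ℂ) * u),
    ⟨?_, ?_, ?_, ?_⟩, ?_⟩
  · exact (hf.continuousOn_invFunOn isOpen_ball).comp (by fun_prop)
      fun t ht => image_mono hsub (hmem t ht)
  · intro t ht
    obtain ⟨y, hy, hfy⟩ := hmem t ht
    simp only [← hfy, hleft (hsub hy)]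
    exact hy
  · simpa using hleft (hsub (ball_subset_closedBall h0r))
  · simp only [one_mul, ← hfx, hleft (hsub hx), hxr]
  · exact fun t ht => Function.invFunOn_eq (image_mono hsub (hmem t ht))

lemma radialModulus_le_pModulus {p : ℝ} (hp : 2 < p) {f : ℂ → ℂ}
    (hf : IsHomeoOn f (ball 0 1)) {r R : ℝ} (hr : 0 < r) (hr1 : r < 1) (hR : 0 < R)
    (hvol : volume (f '' ball 0 r) ≤ volume (closedBall (0 : ℂ) R)) :
    ENNReal.ofReal (2 * Real.pi) * ENNReal.ofReal (radialModulus p R) ≤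
      pModulus p ((fun γ => f ∘ γ) '' radialCurves r) := by
  refine le_iInf₂ fun ρ hρ => ?_
  have hopen : IsOpen (f '' ball 0 r) := hf.2.2 _ (ball_subset_ball hr1.le) isOpen_ball
  have hpre : MeasurableSet ((f 0 + ·) ⁻¹' (f '' ball 0 r)) :=
    (hopen.preimage (continuous_const_add (f 0))).measurableSet
  have hρm := hρ.1
  rw [← lintegral_add_left_eq_self (μ := volume) (fun z => ρ z ^ p) (f 0)]
  refine radialModulus_le_lintegral hp hR hpre (by rwa [measure_preimage_add])
    (ρ := fun z => ρ (f 0 + z)) (by fun_prop) fun θ => ?_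
  obtain ⟨L, hL, hseg, γ, hγ, heq⟩ := hf.exists_radialCurve_segment hr hr1
    (Complex.norm_exp_ofReal_mul_I θ)
  have h1 := hρ.2 _ (mem_image_of_mem (fun γ => f ∘ γ) hγ)
  rw [lineIntegral_congr heq, lineIntegral_segment (Complex.norm_exp_ofReal_mul_I θ) hL] at h1
  calc
    1 ≤ ∫⁻ s in Ioo 0 L, ρ (f 0 + s * Complex.exp (θ * Complex.I)) := h1
    _ = ∫⁻ s in Ioo 0 L, ((f 0 + ·) ⁻¹' (f '' ball 0 r)).indicator (fun z => ρ (f 0 + z))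
          (s * Complex.exp (θ * Complex.I)) := by
      refine setLIntegral_congr_fun measurableSet_Ioo fun s hs => ?_
      exact (indicator_of_mem (hseg s ⟨hs.1.le, hs.2⟩) _).symm
    _ ≤ _ := lintegral_mono_set fun s hs => hs.1

lemma ofReal_le_volume_image_ball {p q₀ r : ℝ} (hp : 2 < p) (hq₀ : 0 < q₀) {Q : ℂ → ℝ≥0∞}
    (hQ : Measurable Q) {f : ℂ → ℂ} (hf : IsQHomeo p (ball 0 1) Q f)
    (hq : ∀ᵐ t ∂(volume.restrict (Ioo (0 : ℝ) 1)), circleMean Q 0 t ≤ ENNReal.ofReal q₀)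
    (hr : 0 < r) (hr1 : r < 1) :
    ENNReal.ofReal (Real.pi * q₀ ^ (2 / (2 - p)) * r ^ 2) ≤ volume (f '' ball 0 r) := by
  have hpi := Real.pi_pos
  have hp0 : 0 < p := by linarith
  have hsub : closedBall (0 : ℂ) r ⊆ ball 0 1 := closedBall_subset_ball hr1
  set V := volume (f '' ball 0 r)
  have hVtop : V ≠ ⊤ := ((measure_mono (image_mono ball_subset_closedBall)).trans_lt
    ((isCompact_closedBall 0 r).image_of_continuousOn (hf.1.1.mono hsub)).measure_lt_top).ne
  have hVpos : 0 < V.toReal := ENNReal.toReal_pos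
    ((hf.1.2.2 _ (ball_subset_ball hr1.le) isOpen_ball).measure_pos _
      ((nonempty_ball.2 hr).image f)).ne' hVtop
  set R := √(V.toReal / Real.pi) with hRdef
  have hR : 0 < R := Real.sqrt_pos.2 (by positivity)
  have hVR : V.toReal = Real.pi * R ^ 2 := by
    rw [hRdef, Real.sq_sqrt (by positivity)]
    field_simp
  have hvol : V ≤ volume (closedBall (0 : ℂ) R) := by
    rw [Complex.volume_closedBall, ← ENNReal.ofReal_toReal hVtop, hVR, mul_comm Real.pi,
      ENNReal.ofReal_mul (by positivity), ENNReal.ofReal_pow hR.le]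
    simp [← ENNReal.ofReal_coe_nnreal]
  have hfam : CurveFamilyIn (radialCurves r) (ball 0 1) :=
    fun γ hγ => ⟨hγ.1, fun t ht => hsub (hγ.2.1 ht)⟩
  have hmod := calc
    ENNReal.ofReal (2 * Real.pi) * ENNReal.ofReal (radialModulus p R)
      ≤ pModulus p ((fun γ => f ∘ γ) '' radialCurves r) :=
        radialModulus_le_pModulus hp hf.1 hr hr1 hR hvol
    _ ≤ ∫⁻ z in ball 0 1, Q z * (closedBall (0 : ℂ) r).indicator
          (fun z => ENNReal.ofReal (radialDensity p r ‖z‖)) z ^ p :=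
        hf.2 _ hfam _ (isAdmissible_radialDensity hp hr)
    _ = ∫⁻ z in closedBall (0 : ℂ) r, Q z * ENNReal.ofReal (radialDensity p r ‖z‖) ^ p := by
        conv_rhs => rw [← inter_eq_self_of_subset_left hsub,
          ← setLIntegral_indicator isClosed_closedBall.measurableSet]
        refine lintegral_congr fun z => ?_
        by_cases hz : z ∈ closedBall (0 : ℂ) r <;> simp [hz, hp0]
    _ ≤ ENNReal.ofReal (2 * Real.pi) * ENNReal.ofReal q₀ * ENNReal.ofReal (radialModulus p r) :=
        setLIntegral_mul_radialDensity_le hp hr hQ (ae_restrict_of_ae_restrict_of_subset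
          (Ioc_subset_Ioo_right hr1) hq)
  have hreal : R ^ (2 - p) ≤ q₀ * r ^ (2 - p) := by
    rw [mul_assoc, ENNReal.mul_le_mul_iff_right (by simp [hpi]) ENNReal.ofReal_ne_top,
      ← ENNReal.ofReal_mul hq₀.le, ENNReal.ofReal_le_ofReal_iff
        (mul_nonneg hq₀.le (radialModulus_nonneg hp hr.le)), radialModulus, radialModulus,
      mul_left_comm] at hmod
    exact le_of_mul_le_mul_left hmod (Real.rpow_pos_of_pos (radialExponent_pos hp) _)
  have hinv := Real.rpow_le_rpow_of_nonpos (Real.rpow_pos_of_pos hR (2 - p)) hreal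
    (div_nonpos_of_nonneg_of_nonpos zero_le_two (by linarith : 2 - p ≤ 0))
  have hsq : ∀ x : ℝ, 0 < x → (x ^ (2 - p)) ^ (2 / (2 - p)) = x ^ 2 := fun x hx => by
    rw [← Real.rpow_mul hx.le, mul_div_cancel₀ _ (by linarith), Real.rpow_two]
  rw [Real.mul_rpow hq₀.le (by positivity), hsq r hr, hsq R hR] at hinv
  rw [← ENNReal.ofReal_toReal hVtop, hVR, mul_assoc]
  exact ENNReal.ofReal_le_ofReal (by gcongr)

/-- For every `Q`-homeomorphism `f : 𝔹 → ℂ` w.r.t. the `p`-modulus, `p > 2`, with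
`q(t) ≤ q₀` a.e. on `(0,1)`, the area functional satisfies
`S_r(f) = |fB_r| ≥ π q₀^{2/(2-p)} r²` for every `r ∈ [0,1]`. -/
theorem area_functional_lower_bound
    (p : ℝ) (hp : 2 < p) (q₀ : ℝ) (hq₀ : 0 < q₀)
    (Q : ℂ → ℝ≥0∞) (hQmeas : Measurable Q)
    (f : ℂ → ℂ) (hf : IsQHomeo p (Metric.ball (0 : ℂ) 1) Q f)
    (hq : ∀ᵐ t ∂(volume.restrict (Set.Ioo (0 : ℝ) 1)),
      circleMean Q 0 t ≤ ENNReal.ofReal q₀)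
    (r : ℝ) (hr : r ∈ Set.Icc (0 : ℝ) 1) :
    ENNReal.ofReal (Real.pi * q₀ ^ (2 / (2 - p)) * r ^ 2) ≤
      volume (f '' Metric.closedBall (0 : ℂ) r) := by
  have hball : ∀ s ∈ Ioo 0 r, ENNReal.ofReal (Real.pi * q₀ ^ (2 / (2 - p)) * s ^ 2) ≤
      volume (f '' closedBall 0 r) := fun s hs =>
    (ofReal_le_volume_image_ball hp hq₀ hQmeas hf hq hs.1 (hs.2.trans_le hr.2)).trans
      (measure_mono (image_mono
        (ball_subset_closedBall.trans (closedBall_subset_closedBall hs.2.le))))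
  rcases hr.1.eq_or_lt with rfl | hr0
  · simp
  have hlim : Filter.Tendsto
      (fun s : ℝ => ENNReal.ofReal (Real.pi * q₀ ^ (2 / (2 - p)) * s ^ 2))
      (nhdsWithin r (Iio r)) (nhds (ENNReal.ofReal (Real.pi * q₀ ^ (2 / (2 - p)) * r ^ 2))) :=
    (ENNReal.continuous_ofReal.comp (by fun_prop)).continuousWithinAt
  exact le_of_tendsto hlim (Filter.eventually_of_mem (Ioo_mem_nhdsLT hr0) hball)
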